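/- Let T be a circle-tree and suppose that the sequence of circles C(0),…,C(k−1) determines T and the sequence of circles C'(0),…,C'(k−1) also determines T. Then there is a bijection f : {0,…,k−1} → {0,…,k−1} such that C(i) = C'(f(i)) for every i < k. In particular, the set of circles making up a circle-tree is uniquely determined. -/

import Mathlib

/-- `C` is a circle in `G`: a finite set of vertices whose induced subgraph is connected
and in which every vertex has exactly two neighbors within `C`. -/
def IsCircleIn {V : Type*} (G : SimpleGraph V) (C : Set V) : Prop :=
  C.Finite ∧ (G.induce C).Connected ∧ ∀ x ∈ C, (G.neighborSet x ∩ C).ncard = 2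

/-- The sequence of pairwise disjoint circles `C 0, …, C (k-1)` determines the induced
subgraph of `G` on `T` as a circle-tree: `T` is the union of the circles, and for each
`0 < j < k`, the graph built from the circles `C 0, …, C (j-1)` is joined to the circle
`C j` by exactly one edge, whose endpoint in the earlier part has degree `2` there. -/
def Determines {V : Type*} (G : SimpleGraph V) (T : Set V) (k : ℕ) (C : ℕ → Set V) : Prop :=
  0 < k ∧
  (∀ i, i < k → IsCircleIn G (C i)) ∧
  (∀ i j, i < k → j < k → i ≠ j → Disjoint (C i) (C j)) ∧
  (⋃ i ∈ Set.Iio k, C i) = T ∧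
  ∀ j, 0 < j → j < k →
    (∃! p : V × V, p.1 ∈ (⋃ i ∈ Set.Iio j, C i) ∧ p.2 ∈ C j ∧ G.Adj p.1 p.2) ∧
    (∀ x y : V, x ∈ (⋃ i ∈ Set.Iio j, C i) → y ∈ C j → G.Adj x y →
      (G.neighborSet x ∩ (⋃ i ∈ Set.Iio j, C i)).ncard = 2)

/-- The induced subgraph of `G` on `T` is a circle-tree. -/
def IsCircleTree {V : Type*} (G : SimpleGraph V) (T : Set V) : Prop :=
  ∃ k C, Determines G T k C

/-- A nonempty part of a connected vertex set that is closed under adjacency is everything. -/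
theorem subset_of_induce_connected {V : Type*} {G : SimpleGraph V} {D A : Set V}
    (hD : (G.induce D).Connected) {a : V} (haA : a ∈ A) (haD : a ∈ D)
    (hA : ∀ x ∈ A, ∀ y ∈ D, x ∈ D → G.Adj x y → y ∈ A) : D ⊆ A := by
  intro b hb
  by_contra hbA
  obtain ⟨p⟩ := hD.preconnected ⟨a, haD⟩ ⟨b, hb⟩
  obtain ⟨d, -, hd₁, hd₂⟩ := p.exists_boundary_dart (Subtype.val ⁻¹' A) haA hbA
  exact hd₂ (hA _ hd₁ _ d.snd.2 d.fst.2 d.adj)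

/-- No edge of a finite `2`-regular graph is the only edge leaving a vertex set. -/
theorem not_unique_boundary_edge {V : Type*} {G : SimpleGraph V} {D A : Set V} (hfin : D.Finite)
    (hdeg : ∀ x ∈ D, (G.neighborSet x ∩ D).ncard = 2) (hAD : A ⊆ D) {a b : V}
    (ha : a ∈ A) (hb : b ∈ D) (hbA : b ∉ A) (hab : G.Adj a b)
    (huniq : ∀ x ∈ A, ∀ y ∈ D, y ∉ A → G.Adj x y → x = a ∧ y = b) : False := by
  classical
  have hAfin : A.Finite := hfin.subset hAD
  have : Fintype A := hAfin.fintype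
  have hdegree (x : A) : (G.induce A).degree x = (G.neighborSet x ∩ A).ncard := by
    rw [← SimpleGraph.card_neighborFinset_eq_degree, ← Set.ncard_coe_finset,
      ← Set.ncard_image_of_injective _ Subtype.val_injective]
    congr 1
    ext y
    simp
  have hodd (x : A) : Odd ((G.induce A).degree x) ↔ x = ⟨a, ha⟩ := by
    rw [hdegree]
    constructor
    · intro hx
      by_contra hne
      have heq : G.neighborSet x ∩ A = G.neighborSet x ∩ D := by
        ext y
        refine ⟨fun hy => ⟨hy.1, hAD hy.2⟩, fun hy => ⟨hy.1, ?_⟩⟩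
        by_contra hyA
        exact hne (Subtype.ext (huniq x x.2 y hy.2 hyA hy.1).1)
      rw [heq, hdeg x (hAD x.2)] at hx
      exact absurd hx (by decide)
    · rintro rfl
      have heq : G.neighborSet a ∩ D = insert b (G.neighborSet a ∩ A) := by
        ext y
        constructor
        · intro hy
          by_cases hyA : y ∈ A
          · exact Or.inr ⟨hy.1, hyA⟩
          · exact Or.inl (huniq a ha y hy.2 hyA hy.1).2
        · rintro (rfl | hy)
          · exact ⟨hab, hb⟩
          · exact ⟨hy.1, hAD hy.2⟩
      have hcard := hdeg a (hAD ha)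
      rw [heq, Set.ncard_insert_of_notMem (fun h => hbA h.2)
        (hAfin.subset Set.inter_subset_right)] at hcard
      have hone : (G.neighborSet a ∩ A).ncard = 1 := by omega
      simp [hone]
  have heven := (G.induce A).even_card_odd_degree_vertices
  rw [Finset.card_eq_one.2 ⟨⟨a, ha⟩, by ext x; simp [hodd]⟩] at heven
  exact absurd heven (by decide)

/-- A circle contained in another circle is equal to it. -/
theorem IsCircleIn.eq_of_subset {V : Type*} {G : SimpleGraph V} {D E : Set V}
    (hD : IsCircleIn G D) (hE : IsCircleIn G E) (hDE : D ⊆ E) : D = E := by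
  obtain ⟨a, ha⟩ := hD.2.1.nonempty
  refine hDE.antisymm (subset_of_induce_connected hE.2.1 ha (hDE ha) fun x hx y hy _ hxy => ?_)
  have heq : G.neighborSet x ∩ D = G.neighborSet x ∩ E :=
    Set.eq_of_subset_of_ncard_le (Set.inter_subset_inter_right _ hDE)
      (by rw [hD.2.2 x hx, hE.2.2 x (hDE hx)]) (hE.1.subset Set.inter_subset_right)
  exact (heq.ge ⟨hxy, hy⟩).2

/-- Every circle inside a circle-tree is one of the circles of a determining sequence. -/
theorem Determines.exists_eq_of_isCircleIn {V : Type*} {G : SimpleGraph V} {T D : Set V} {k : ℕ}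
    {C : ℕ → Set V} (h : Determines G T k C) (hD : IsCircleIn G D) (hDT : D ⊆ T) :
    ∃ i < k, D = C i := by
  classical
  obtain ⟨-, hcirc, -, hunion, hedge⟩ := h
  have hcover : ∀ x ∈ D, ∃ i < k, x ∈ C i := fun x hx => by
    simpa [← hunion] using hDT hx
  obtain ⟨x₀, hx₀⟩ := hD.2.1.nonempty
  obtain ⟨i₀, hi₀, hxi₀⟩ := hcover x₀ hx₀
  let P : ℕ → Prop := fun j => j < k ∧ (D ∩ C j).Nonempty
  set j := Nat.findGreatest P k
  obtain ⟨hjk, a₀, ha₀D, ha₀C⟩ : P j :=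
    Nat.findGreatest_spec (P := P) hi₀.le ⟨hi₀, x₀, hx₀, hxi₀⟩
  have hearlier : ∀ y ∈ D, y ∉ C j → y ∈ ⋃ i ∈ Set.Iio j, C i := by
    intro y hy hyj
    obtain ⟨i, hi, hyi⟩ := hcover y hy
    have hij : i ≤ j := Nat.le_findGreatest hi.le ⟨hi, y, hy, hyi⟩
    have hne : i ≠ j := by rintro rfl; exact hyj hyi
    exact Set.mem_biUnion (Set.mem_Iio.2 (lt_of_le_of_ne hij hne)) hyi
  refine ⟨j, hjk, hD.eq_of_subset (hcirc j hjk) ?_⟩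
  refine subset_of_induce_connected hD.2.1 ha₀C ha₀D fun a ha b hb haD hab => ?_
  by_contra hbC
  have hb' := hearlier b hb hbC
  have hj0 : 0 < j := by
    obtain ⟨i, hi, -⟩ := Set.mem_iUnion₂.1 hb'
    exact (Nat.zero_le i).trans_lt hi
  refine not_unique_boundary_edge hD.1 hD.2.2 (Set.inter_subset_left (t := C j)) ⟨haD, ha⟩ hb
    (fun h => hbC h.2) hab fun x hx y hy hyA hxy => ?_
  have heq := (hedge j hj0 hjk).1.unique (y₁ := (y, x)) (y₂ := (b, a))
    ⟨hearlier y hy fun h => hyA ⟨hy, h⟩, hx.2, hxy.symm⟩ ⟨hb', ha, hab.symm⟩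
  exact ⟨congrArg Prod.snd heq, congrArg Prod.fst heq⟩

theorem stmt9 {V : Type} (G : SimpleGraph V) (T : Set V) (k : ℕ)
    (C C' : ℕ → Set V)
    (h : Determines G T k C) (h' : Determines G T k C') :
    ∃ e : Fin k ≃ Fin k, ∀ i : Fin k, C i.val = C' ((e i).val) := by
  have hex : ∀ i : Fin k, ∃ m : Fin k, C i = C' m := fun i => by
    have hsub : C i ⊆ T := h.2.2.2.1 ▸ Set.subset_biUnion_of_mem (u := C) (Set.mem_Iio.2 i.2)
    obtain ⟨m, hm, heq⟩ := h'.exists_eq_of_isCircleIn (h.2.1 i i.2) hsub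
    exact ⟨⟨m, hm⟩, heq⟩
  choose f hf using hex
  have hinj : Function.Injective f := fun i j hij => by
    by_contra hne
    have heq : C i = C j := by rw [hf i, hf j, hij]
    have hdisj := h.2.2.1 i j i.2 j.2 (Fin.val_ne_of_ne hne)
    rw [heq, disjoint_self] at hdisj
    obtain ⟨a, ha⟩ := (h.2.1 j j.2).2.1.nonempty
    exact hdisj.le ha
  exact ⟨Equiv.ofBijective f (Finite.injective_iff_bijective.1 hinj), hf⟩
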